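/- arXiv:2110.06358 — 2 statements merged into one kernel-verified Lean document; each statement's English description precedes it below -/
import Mathlib

section
/- Let K be a pure simplicial complex of dimension n−1 on the vertex set {1,…,m} (so every maximal simplex of K has exactly n elements), and suppose the integer vectors λ₁,…,λₙ, θ₁,…,θ_{m−n} ∈ ℤ^m satisfy: (1) λ₁,…,λₙ,θ₁,…,θ_{m−n} are linearly independent over ℚ; (2) the standard dot product λᵢ·θⱼ equals 0 for every i = 1,…,n and j = 1,…,m−n. Let Λ be the n×m matrix with rows λ₁,…,λₙ and Θ the (m−n)×m matrix with rows θ₁,…,θ_{m−n}. Then Λ is a rational characteristic matrix of K if and only if det Θ(σ̄) ≠ 0 for every maximal simplex σ ∈ K, where σ̄ denotes the complement of σ in {1,…,m}. -/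
/-- A simplicial complex on the vertex set `{1,…,m}` (modeled as `Fin m`):
a collection of finite subsets closed under taking subsets and containing `∅`. -/
def IsSimplicialComplex {m : ℕ} (K : Set (Finset (Fin m))) : Prop :=
  ∅ ∈ K ∧ ∀ σ ∈ K, ∀ τ ⊆ σ, τ ∈ K

/-- `σ` is a maximal simplex of `K`. -/
def IsMaximalSimplex {m : ℕ} (K : Set (Finset (Fin m))) (σ : Finset (Fin m)) : Prop :=
  σ ∈ K ∧ ∀ τ ∈ K, σ ⊆ τ → σ = τ

/-- The submatrix `A(σ)` of an `r × m` matrix `A` consisting of the columns indexed by the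
`k`-element subset `σ ⊆ {1,…,m}`, the columns being taken in increasing order. -/
noncomputable def colSub {r m k : ℕ} {α : Type*} (A : Matrix (Fin r) (Fin m) α)
    (σ : Finset (Fin m)) (h : σ.card = k) : Matrix (Fin r) (Fin k) α :=
  A.submatrix id (fun j => (σ.orderIsoOfFin h j : Fin m))

/-- An `n × m` integer matrix `Λ` is a rational characteristic matrix of `K` if for every
simplex `σ ∈ K` the columns of `Λ` indexed by `σ` are linearly independent over `ℚ`. -/
def IsRationalCharMatrix {n m : ℕ} (K : Set (Finset (Fin m)))
    (Λ : Matrix (Fin n) (Fin m) ℤ) : Prop :=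
  ∀ σ ∈ K, LinearIndependent ℚ (fun j : {x // x ∈ σ} => fun i : Fin n => (Λ i (j : Fin m) : ℚ))

/-- If the rows of `L` and `T` together form a basis of `ℚ ^ V` and the rows of `T` lie in the
kernel of `L`, then that kernel is contained in the row space of `T`. -/
theorem exists_vecMul_eq_of_mulVec_eq_zero {ι κ V : Type*} [Fintype ι] [Fintype κ] [Fintype V]
    (L : Matrix ι V ℚ) (T : Matrix κ V ℚ) (hind : LinearIndependent ℚ (Sum.elim L.row T.row))
    (hcard : Fintype.card ι + Fintype.card κ = Fintype.card V)
    (horth : ∀ c, L.mulVec (Matrix.vecMul c T) = 0) {v : V → ℚ} (hv : L.mulVec v = 0) :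
    ∃ c, Matrix.vecMul c T = v := by
  have hspan := hind.span_eq_top_of_card_eq_finrank' (by simp [hcard])
  have hmem : v ∈ Submodule.span ℚ (Set.range (Sum.elim L.row T.row)) := hspan ▸ trivial
  obtain ⟨a, ha⟩ := (Submodule.mem_span_range_iff_exists_fun ℚ).1 hmem
  have hdecomp : Matrix.vecMul (a ∘ Sum.inl) L + Matrix.vecMul (a ∘ Sum.inr) T = v := by
    rw [← ha, Fintype.sum_sum_type, Matrix.vecMul_eq_sum, Matrix.vecMul_eq_sum]
    rfl
  have hL : L.mulVec (Matrix.vecMul (a ∘ Sum.inl) L) = 0 := by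
    simpa [← hdecomp, Matrix.mulVec_add, horth] using hv
  have hzero : Matrix.vecMul (a ∘ Sum.inl) L = 0 := by
    rw [← dotProduct_self_eq_zero, ← Matrix.dotProduct_mulVec, hL, dotProduct_zero]
  exact ⟨a ∘ Sum.inr, by simpa [hzero] using hdecomp⟩

/-- Columns of a matrix indexed by `σ` are independent iff no nonzero vector of the kernel is
supported on `σ`. -/
theorem linearIndependent_col_iff {ι V : Type*} [Fintype V]
    (L : Matrix ι V ℚ) (σ : Finset V) :
    LinearIndependent ℚ (fun j : {x // x ∈ σ} => L.col j) ↔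
      ∀ v : V → ℚ, (∀ x ∉ σ, v x = 0) → L.mulVec v = 0 → v = 0 := by
  classical
  refine (linearIndepOn_finset_iff (R := ℚ) (v := L.col) (s := σ)).trans ⟨fun h v hv hL => ?_,
    fun h f hf => ?_⟩
  · have hsum : ∑ x ∈ σ, v x • L.col x = 0 := by
      rw [Finset.sum_subset (Finset.subset_univ σ) fun x _ hx => by simp [hv x hx], ← hL,
        Matrix.mulVec_eq_sum]
      simp [Matrix.col]
    ext x
    by_cases hx : x ∈ σ
    · exact h v hsum x hx
    · exact hv x hx
  · have hzero := h (fun x => if x ∈ σ then f x else 0) (fun x hx => by simp [hx]) (by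
      rw [← hf, Matrix.mulVec_eq_sum]
      simp [Matrix.col])
    intro x hx
    simpa [hx] using congrFun hzero x

/-- For `L` and `T` with complementary orthogonal row spaces, the columns of `L` indexed by `σ`
are independent iff the columns of `T` indexed by the complement of `σ` form a nonsingular
matrix. -/
theorem linearIndependent_col_iff_det_ne_zero {ι κ V : Type*} [Fintype ι] [Fintype κ]
    [DecidableEq κ] [Fintype V] (L : Matrix ι V ℚ) (T : Matrix κ V ℚ)
    (hind : LinearIndependent ℚ (Sum.elim L.row T.row))
    (hcard : Fintype.card ι + Fintype.card κ = Fintype.card V)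
    (horth : L * T.transpose = 0) (σ : Finset V) (e : κ → V) (he : ∀ x, x ∉ σ ↔ ∃ j, e j = x) :
    LinearIndependent ℚ (fun j : {x // x ∈ σ} => L.col j) ↔ (T.submatrix id e).det ≠ 0 := by
  have horth' (c : κ → ℚ) : L.mulVec (Matrix.vecMul c T) = 0 := by
    rw [← Matrix.mulVec_transpose, Matrix.mulVec_mulVec, horth, Matrix.zero_mulVec]
  have hrow : LinearIndependent ℚ T.row := hind.comp Sum.inr Sum.inr_injective
  rw [linearIndependent_col_iff, ne_eq, ← Matrix.exists_vecMul_eq_zero_iff]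
  refine ⟨fun h ⟨c, hc, hcT⟩ => hc ?_, fun h v hv hL => ?_⟩
  · refine Matrix.vecMul_injective_iff.2 hrow ?_
    simp only [Matrix.zero_vecMul]
    refine h _ (fun x hx => ?_) (horth' c)
    obtain ⟨j, rfl⟩ := (he x).1 hx
    exact congrFun hcT j
  · obtain ⟨c, rfl⟩ := exists_vecMul_eq_of_mulVec_eq_zero L T hind hcard horth' hL
    by_contra hne
    exact h ⟨c, fun hc => hne (by simp [hc]), funext fun j => hv _ ((he _).2 ⟨j, rfl⟩)⟩

/-- Every simplex lies in a maximal one. -/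
theorem exists_isMaximalSimplex {m : ℕ} {K : Set (Finset (Fin m))} {τ : Finset (Fin m)}
    (hτ : τ ∈ K) : ∃ σ, IsMaximalSimplex K σ ∧ τ ⊆ σ := by
  obtain ⟨σ, hτσ, hσ⟩ := K.toFinite.exists_le_maximal hτ
  exact ⟨σ, ⟨hσ.prop, fun ρ hρ h => hσ.eq_of_le hρ h⟩, hτσ⟩

/-- Lemma 4.3: for a pure `(n-1)`-dimensional simplicial complex `K` on `m` vertices and
integer vectors `λ₁,…,λₙ,θ₁,…,θ_{m-n} ∈ ℤ^m` that are linearly independent over `ℚ` and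
pairwise orthogonal (each `λᵢ ⊥ θⱼ`), the matrix `Λ` with rows `λᵢ` is a rational
characteristic matrix of `K` iff `det Θ(σ̄) ≠ 0` for every maximal simplex `σ ∈ K`,
where `Θ` has rows `θⱼ` and `σ̄` is the complement of `σ`. -/
theorem stmt0 {m n : ℕ} (K : Set (Finset (Fin m)))
    (hK : IsSimplicialComplex K)
    (hpure : ∀ σ, IsMaximalSimplex K σ → σ.card = n)
    (lam : Fin n → Fin m → ℤ) (θ : Fin (m - n) → Fin m → ℤ)
    (hindep : LinearIndependent ℚ
      (Sum.elim (fun i => fun x => (lam i x : ℚ)) (fun j => fun x => (θ j x : ℚ))))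
    (horth : ∀ i j, ∑ x, lam i x * θ j x = 0) :
    IsRationalCharMatrix K (Matrix.of lam) ↔
      ∀ σ, IsMaximalSimplex K σ → ∀ h : σᶜ.card = m - n,
        (colSub (Matrix.of θ) σᶜ h).det ≠ 0 := by
  obtain ⟨ρ, hρ, -⟩ := exists_isMaximalSimplex hK.1
  have hnm : n ≤ m := by simpa [hpure ρ hρ] using Finset.card_le_univ ρ
  let L : Matrix (Fin n) (Fin m) ℚ := Matrix.of fun i x => (lam i x : ℚ)
  let T : Matrix (Fin (m - n)) (Fin m) ℚ := Matrix.of fun j x => (θ j x : ℚ)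
  have hLT : L * T.transpose = 0 := by
    ext i j
    simpa [L, T, Matrix.mul_apply] using mod_cast horth i j
  have key (σ : Finset (Fin m)) (h : σᶜ.card = m - n) :
      LinearIndependent ℚ (fun j : {x // x ∈ σ} => L.col j) ↔
        (colSub (Matrix.of θ) σᶜ h).det ≠ 0 := by
    rw [linearIndependent_col_iff_det_ne_zero L T hindep (by simp [hnm]) hLT σ
      (fun j => (σᶜ.orderIsoOfFin h j : Fin m)) fun x => ?_]
    · have hmap : T.submatrix id (fun j => (σᶜ.orderIsoOfFin h j : Fin m)) =
          (colSub (Matrix.of θ) σᶜ h).map (Int.cast : ℤ → ℚ) := rfl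
      rw [hmap, ← Int.cast_det, Int.cast_ne_zero]
    · rw [← Finset.mem_compl]
      refine ⟨fun hx => ⟨(σᶜ.orderIsoOfFin h).symm ⟨x, hx⟩, by simp⟩, ?_⟩
      rintro ⟨j, rfl⟩
      exact (σᶜ.orderIsoOfFin h j).2
  refine ⟨fun h σ hσ hc => (key σ hc).1 (h σ hσ.1), fun h τ hτ => ?_⟩
  obtain ⟨σ, hσ, hτσ⟩ := exists_isMaximalSimplex hτ
  have hc : σᶜ.card = m - n := by rw [Finset.card_compl, hpure σ hσ, Fintype.card_fin]
  exact ((key σ hc).2 (h σ hσ hc)).comp (fun x : {x // x ∈ τ} => ⟨x, hτσ x.2⟩)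
    fun x y hxy => Subtype.ext (Subtype.mk.inj hxy)
end

section
/- Let A be an m×k integer matrix whose rank over ℚ equals k, and let φ_A : (S¹)^k → (S¹)^m be the continuous group homomorphism φ_A(t)_i = ∏_{j=1}^{k} t_j^{A_{ij}}. Then the image of φ_A is a closed subgroup of (S¹)^m, and the quotient topological group (S¹)^m / im(φ_A) is isomorphic, as a topological group, to the torus (S¹)^{m−k}. -/
/-- The continuous group homomorphism of tori `φ_B : (S¹)^s → (S¹)^r` induced by an
`r × s` integer matrix `B`, given by `φ_B(t)_i = ∏_j t_j ^ B i j`. -/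
noncomputable def phiHom {r s : ℕ} (B : Matrix (Fin r) (Fin s) ℤ) :
    (Fin s → Circle) →* (Fin r → Circle) where
  toFun t := fun i => ∏ j, t j ^ B i j
  map_one' := by funext i; simp
  map_mul' t u := by funext i; simp [mul_zpow, Finset.prod_mul_distrib]

lemma phiHom_apply {r s : ℕ} (B : Matrix (Fin r) (Fin s) ℤ) (t : Fin s → Circle) (i : Fin r) :
    phiHom B t i = ∏ j, t j ^ B i j := rfl

lemma phiHom_one {r : ℕ} (t : Fin r → Circle) : phiHom (1 : Matrix (Fin r) (Fin r) ℤ) t = t := by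
  funext i
  rw [phiHom_apply, Finset.prod_eq_single i]
  · simp
  · intro j _ hj
    simp [Matrix.one_apply_ne hj.symm]
  · simp

lemma prod_zpow_eq_zpow_sum {G ι : Type*} [CommGroup G] (s : Finset ι) (f : ι → ℤ) (g : G) :
    ∏ i ∈ s, g ^ f i = g ^ ∑ i ∈ s, f i :=
  (map_sum (zpowersHom G g).toAdditiveRight f s).symm

lemma phiHom_mul {r s u : ℕ} (B : Matrix (Fin r) (Fin s) ℤ) (C : Matrix (Fin s) (Fin u) ℤ)
    (t : Fin u → Circle) : phiHom (B * C) t = phiHom B (phiHom C t) := by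
  funext i
  simp only [phiHom_apply, Matrix.mul_apply, ← Finset.prod_zpow]
  rw [Finset.prod_comm]
  refine Finset.prod_congr rfl fun j _ => ?_
  rw [← prod_zpow_eq_zpow_sum]
  refine Finset.prod_congr rfl fun l _ => ?_
  rw [← zpow_mul, mul_comm]

lemma continuous_phiHom {r s : ℕ} (B : Matrix (Fin r) (Fin s) ℤ) : Continuous (phiHom B) :=
  continuous_pi fun i => by
    simp only [phiHom_apply]
    fun_prop

lemma Circle.zpow_surjective {n : ℤ} (hn : n ≠ 0) :
    Function.Surjective fun z : Circle => z ^ n := by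
  have : NeZero n := ⟨hn⟩
  exact (Circle.isQuotientCoveringMap_zpow n).surjective

/-- A generalized diagonal matrix, with the entry `a j` in row `f j` of column `j`. -/
def embeddedDiagonal {m k : ℕ} (f : Fin k ↪ Fin m) (a : Fin k → ℤ) : Matrix (Fin m) (Fin k) ℤ :=
  Matrix.of fun i j => if i = f j then a j else 0

lemma phiHom_embeddedDiagonal_apply {m k : ℕ} (f : Fin k ↪ Fin m) (a : Fin k → ℤ)
    (t : Fin k → Circle) (j : Fin k) : phiHom (embeddedDiagonal f a) t (f j) = t j ^ a j := by
  rw [phiHom_apply, Finset.prod_eq_single j]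
  · simp [embeddedDiagonal]
  · intro l _ hl
    simp [embeddedDiagonal, hl.symm]
  · simp

lemma phiHom_embeddedDiagonal_apply_of_notMem {m k : ℕ} (f : Fin k ↪ Fin m) (a : Fin k → ℤ)
    (t : Fin k → Circle) {i : Fin m} (hi : i ∉ Set.range f) :
    phiHom (embeddedDiagonal f a) t i = 1 := by
  rw [phiHom_apply]
  refine Finset.prod_eq_one fun j _ => ?_
  have : i ≠ f j := fun h => hi ⟨j, h.symm⟩
  simp [embeddedDiagonal, this]

lemma mem_range_phiHom_embeddedDiagonal {m k : ℕ} (f : Fin k ↪ Fin m) {a : Fin k → ℤ}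
    (ha : ∀ j, a j ≠ 0) (x : Fin m → Circle) :
    x ∈ (phiHom (embeddedDiagonal f a)).range ↔ ∀ i ∉ Set.range f, x i = 1 := by
  constructor
  · rintro ⟨t, rfl⟩ i hi
    exact phiHom_embeddedDiagonal_apply_of_notMem f a t hi
  · intro hx
    choose t ht using fun j => Circle.zpow_surjective (ha j) (x (f j))
    refine ⟨t, funext fun i => ?_⟩
    by_cases hi : i ∈ Set.range f
    · obtain ⟨j, rfl⟩ := hi
      rw [phiHom_embeddedDiagonal_apply]
      exact ht j
    · rw [phiHom_embeddedDiagonal_apply_of_notMem f a t hi, hx i hi]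

lemma mulVec_injective_of_rank_map_eq {m k : ℕ} (A : Matrix (Fin m) (Fin k) ℤ)
    (hrank : (A.map ((↑) : ℤ → ℚ)).rank = k) : Function.Injective A.mulVecLin := by
  rw [← LinearMap.ker_eq_bot, LinearMap.ker_eq_bot']
  intro v hv
  have hker : LinearMap.ker (A.map ((↑) : ℤ → ℚ)).mulVecLin = ⊥ := by
    have h := LinearMap.finrank_range_add_finrank_ker (A.map ((↑) : ℤ → ℚ)).mulVecLin
    rw [← Matrix.rank, hrank, Module.finrank_fin_fun] at h
    exact Submodule.finrank_eq_zero.mp (by omega)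
  have hcast : (A.map ((↑) : ℤ → ℚ)).mulVecLin (fun j => (v j : ℚ)) = 0 := by
    funext i
    have hi := congrFun hv i
    simp only [Matrix.mulVecLin_apply, Matrix.mulVec, dotProduct, Pi.zero_apply] at hi
    simp only [Matrix.mulVecLin_apply, Matrix.mulVec, dotProduct, Pi.zero_apply, Matrix.map_apply]
    exact_mod_cast hi
  have hzero := (LinearMap.ker_eq_bot'.mp hker) _ hcast
  funext j
  exact Int.cast_eq_zero.mp (congrFun hzero j)

/-- A Smith normal form for integer matrices of full column rank: `A` and `U * D`, with `U`
invertible and `D` generalized diagonal, are right multiples of each other. -/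
lemma exists_mul_embeddedDiagonal {m k : ℕ} (A : Matrix (Fin m) (Fin k) ℤ)
    (hA : Function.Injective A.mulVecLin) :
    ∃ (U V : Matrix (Fin m) (Fin m) ℤ) (f : Fin k ↪ Fin m) (a : Fin k → ℤ)
      (P Q : Matrix (Fin k) (Fin k) ℤ), U * V = 1 ∧ V * U = 1 ∧ (∀ j, a j ≠ 0) ∧
      U * embeddedDiagonal f a = A * P ∧ A = U * embeddedDiagonal f a * Q := by
  obtain ⟨n, snf⟩ := (LinearMap.range A.mulVecLin).smithNormalForm (Pi.basisFun ℤ (Fin m))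
  obtain rfl : n = k := by
    have h := Module.finrank_eq_card_basis snf.bN
    rw [LinearMap.finrank_range_of_inj hA] at h
    simpa using h.symm
  have hcol : ∀ i j, ((Pi.basisFun ℤ (Fin m)).toMatrix snf.bM * embeddedDiagonal snf.f snf.a) i j =
      (snf.bN j : Fin m → ℤ) i := by
    intro i j
    simp [Matrix.mul_apply, embeddedDiagonal, snf.snf, Module.Basis.toMatrix_apply, mul_comm]
  choose p hp using fun j => (snf.bN j).2
  refine ⟨(Pi.basisFun ℤ (Fin m)).toMatrix snf.bM, snf.bM.toMatrix (Pi.basisFun ℤ (Fin m)),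
    snf.f, snf.a, Matrix.of fun i j => p j i,
    Matrix.of fun i j => snf.bN.repr ⟨A.mulVecLin (Pi.single j 1), LinearMap.mem_range_self _ _⟩ i,
    Module.Basis.toMatrix_mul_toMatrix_flip _ _, Module.Basis.toMatrix_mul_toMatrix_flip _ _,
    fun j hj => ?_, ?_, ?_⟩
  · have h := snf.snf j
    rw [hj, zero_smul] at h
    exact snf.bN.ne_zero j (Subtype.ext h)
  · ext i j
    rw [hcol, ← hp]
    rfl
  · ext i j
    have h := congrArg Subtype.val (snf.bN.sum_repr
      ⟨A.mulVecLin (Pi.single j 1), LinearMap.mem_range_self _ _⟩)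
    have hi := congrFun h i
    rw [Matrix.mul_apply]
    simp only [hcol]
    simp only [Matrix.mulVecLin_apply, Matrix.mulVec_single_one, Matrix.col_apply,
      Submodule.coe_sum, Submodule.coe_smul, Finset.sum_apply, Pi.smul_apply, smul_eq_mul] at hi
    rw [← hi]
    refine Finset.sum_congr rfl fun l _ => ?_
    simp [mul_comm]

lemma isClosed_and_exists_quotient_mulEquiv {G H : Type*} [CommGroup G] [TopologicalSpace G]
    [CompactSpace G] [Group H] [TopologicalSpace H] [T2Space H] (ψ : G →* H)
    (hcont : Continuous ψ) (hsurj : Function.Surjective ψ) {N : Subgroup G} (hN : N = ψ.ker) :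
    IsClosed (N : Set G) ∧ ∃ e : (G ⧸ N) ≃* H, Continuous e ∧ Continuous e.symm := by
  subst hN
  refine ⟨isClosed_singleton.preimage hcont, ?_⟩
  let e := QuotientGroup.quotientKerEquivOfSurjective ψ hsurj
  have he : Continuous e := continuous_quot_lift _ hcont
  exact ⟨e, he, he.continuous_symm_of_equiv_compact_to_t2 (f := e.toEquiv)⟩

/-- If `A` is an `m × k` integer matrix of rank `k` over `ℚ`, then the image of
`φ_A : (S¹)^k → (S¹)^m` is a closed subgroup of the torus `(S¹)^m`, and the quotient
topological group `(S¹)^m / im φ_A` is isomorphic, as a topological group, to the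
torus `(S¹)^{m-k}`. -/
theorem stmt10 {m k : ℕ} (A : Matrix (Fin m) (Fin k) ℤ)
    (hrank : (A.map ((↑) : ℤ → ℚ)).rank = k) :
    IsClosed ((phiHom A).range : Set (Fin m → Circle)) ∧
    ∃ e : ((Fin m → Circle) ⧸ (phiHom A).range) ≃* (Fin (m - k) → Circle),
      Continuous e ∧ Continuous e.symm := by
  obtain ⟨U, V, f, a, P, Q, hUV, hVU, ha, hP, hQ⟩ :=
    exists_mul_embeddedDiagonal A (mulVec_injective_of_rank_map_eq A hrank)
  have hUVx : ∀ x, phiHom U (phiHom V x) = x := fun x => by rw [← phiHom_mul, hUV, phiHom_one]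
  have hVUx : ∀ x, phiHom V (phiHom U x) = x := fun x => by rw [← phiHom_mul, hVU, phiHom_one]
  have hmem : ∀ x, x ∈ (phiHom A).range ↔ ∀ i ∉ Set.range f, phiHom V x i = 1 := by
    intro x
    rw [← mem_range_phiHom_embeddedDiagonal f ha]
    constructor
    · rintro ⟨t, rfl⟩
      refine ⟨phiHom Q t, ?_⟩
      conv_rhs => rw [hQ, phiHom_mul, phiHom_mul, hVUx]
    · rintro ⟨t, ht⟩
      exact ⟨phiHom P t, by rw [← phiHom_mul, ← hP, phiHom_mul, ht, hUVx]⟩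
  obtain ⟨g⟩ : Nonempty (Fin (m - k) ≃ {i // i ∉ Set.range f}) := by
    classical
    refine Fintype.card_eq.mp ?_
    have hf : Fintype.card {i // i ∈ Set.range f} = k :=
      (Set.card_range_of_injective f.injective).trans (Fintype.card_fin k)
    rw [Fintype.card_subtype_compl, hf, Fintype.card_fin, Fintype.card_fin]
  let ψ : (Fin m → Circle) →* (Fin (m - k) → Circle) :=
    (MonoidHom.pi fun l => Pi.evalMonoidHom _ (g l).1).comp (phiHom V)
  have hψ : ∀ x l, ψ x l = phiHom V x (g l).1 := fun _ _ => rfl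
  refine isClosed_and_exists_quotient_mulEquiv ψ ?_ ?_ ?_
  · exact continuous_pi fun l => (continuous_apply (g l).1).comp (continuous_phiHom V)
  · intro y
    classical
    refine ⟨phiHom U fun i => if hi : i ∉ Set.range f then y (g.symm ⟨i, hi⟩) else 1, ?_⟩
    funext l
    rw [hψ, hVUx, dif_pos (g l).2]
    simp
  · ext x
    rw [hmem, MonoidHom.mem_ker]
    constructor
    · intro h
      funext l
      exact h _ (g l).2
    · intro h i hi
      simpa [hψ] using congrFun h (g.symm ⟨i, hi⟩)
end
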